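/- arXiv:1703.03984 — 2 statements merged into one kernel-verified Lean document; each statement's English description precedes it below -/
import Mathlib

section
/- Let G be a connected graph of order n ≥ 4. Then sdiam_{n−2}(G) = n − 1 if and only if G contains at least two cut vertices. -/
open SimpleGraph

/-- The Steiner distance of a vertex set `S` in `G`: the minimum number of edges of a
connected subgraph of `G` whose vertex set contains `S` (`⊤` if no such subgraph exists). -/
noncomputable def steinerDist {V : Type*} (G : SimpleGraph V) (S : Set V) : ℕ∞ :=
  sInf {m : ℕ∞ | ∃ H : G.Subgraph, H.Connected ∧ S ⊆ H.verts ∧ m = H.edgeSet.ncard}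

/-- The Steiner `k`-diameter of `G`: the maximum of `steinerDist G S` over all
`k`-element vertex subsets `S`. -/
noncomputable def sdiam {V : Type*} (G : SimpleGraph V) (k : ℕ) : ℕ∞ :=
  sSup {m : ℕ∞ | ∃ S : Set V, S.ncard = k ∧ m = steinerDist G S}

/-- `v` is a cut vertex of `G` if deleting `v` disconnects `G`. -/
def IsCutVertex {V : Type*} (G : SimpleGraph V) (v : V) : Prop :=
  ¬ (G.induce ({v}ᶜ : Set V)).Connected

/-- `U` is a vertex cut set of the induced subgraph `G[A]` if `U ⊆ A` and deleting `U`
from `G[A]` leaves a disconnected graph. -/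
def IsCutSetOf {V : Type*} (G : SimpleGraph V) (A U : Set V) : Prop :=
  U ⊆ A ∧ ¬ (G.induce (A \ U)).Connected

/-- The vertex connectivity of the induced subgraph `G[A]`: the minimum size of a set
`U ⊆ A` whose removal disconnects `G[A]` or reduces it to a single vertex. -/
noncomputable def kappaOn {V : Type*} (G : SimpleGraph V) (A : Set V) : ℕ :=
  sInf {m : ℕ | ∃ U : Set V, U ⊆ A ∧ U.ncard = m ∧
    (¬ (G.induce (A \ U)).Connected ∨ (A \ U).ncard = 1)}

/-- The vertex connectivity `κ(G)`. -/
noncomputable def kappa {V : Type*} (G : SimpleGraph V) : ℕ :=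
  kappaOn G Set.univ

namespace SimpleGraph

variable {V : Type*} {G : SimpleGraph V}

lemma Subgraph.ncard_edgeSet_coe (H : G.Subgraph) :
    H.coe.edgeSet.ncard = H.edgeSet.ncard := by
  rw [← H.image_coe_edgeSet_coe, Set.ncard_image_of_injective]
  exact Sym2.map.injective Subtype.val_injective

lemma Subgraph.Connected.ncard_verts_le {H : G.Subgraph} (hH : H.Connected) :
    H.verts.ncard ≤ H.edgeSet.ncard + 1 := by
  rw [← H.ncard_edgeSet_coe]
  exact hH.coe.card_vert_le_card_edgeSet_add_one

/-- A finite connected induced subgraph is spanned by a subtree of the ambient graph. -/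
lemma exists_connected_subgraph_of_connected_induce {A : Set V} (hfin : A.Finite)
    (hA : (G.induce A).Connected) :
    ∃ H : G.Subgraph, H.Connected ∧ H.verts = A ∧ H.edgeSet.ncard + 1 = A.ncard := by
  obtain ⟨T, hTG, hT⟩ := hA.exists_isTree_le
  let H : G.Subgraph :=
    { verts := A
      Adj := fun a b => ∃ (ha : a ∈ A) (hb : b ∈ A), T.Adj ⟨a, ha⟩ ⟨b, hb⟩
      adj_sub := fun ⟨_, _, h⟩ => hTG h
      edge_vert := fun ⟨ha, _, _⟩ => ha
      symm := ⟨fun _ _ ⟨ha, hb, h⟩ => ⟨hb, ha, h.symm⟩⟩ }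
  have hHT : H.coe = T := by
    ext ⟨a, ha⟩ ⟨b, hb⟩
    exact ⟨fun ⟨_, _, h⟩ => h, fun h => ⟨ha, hb, h⟩⟩
  refine ⟨H, ⟨hHT ▸ hT.connected⟩, rfl, ?_⟩
  rw [← H.ncard_edgeSet_coe, hHT]
  have : Finite A := hfin
  exact (isTree_iff_connected_and_card.1 hT).2

lemma Connected.exists_adj_notMem_of_mem (hG : G.Connected) {s : Set V} {a b : V}
    (ha : a ∈ s) (hb : b ∉ s) : ∃ x ∈ s, ∃ y ∉ s, G.Adj x y := by
  obtain ⟨p⟩ := hG.preconnected a b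
  obtain ⟨d, -, h₁, h₂⟩ := p.exists_boundary_dart s ha hb
  exact ⟨_, h₁, _, h₂, d.adj⟩

lemma connected_induce_insert {A : Set V} {u a : V} (hA : (G.induce A).Connected)
    (ha : a ∈ A) (hua : G.Adj u a) : (G.induce (insert u A)).Connected := by
  have h := induce_union_connected (induce_pair_connected_of_adj hua).preconnected
    hA.preconnected ⟨a, by simp, ha⟩
  rwa [Set.insert_union, Set.singleton_union, Set.insert_eq_of_mem ha] at h

end SimpleGraph

section

variable {V : Type*} {G : SimpleGraph V}

lemma steinerDist_add_one_le [Finite V] {A S : Set V} (hA : (G.induce A).Connected)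
    (hS : S ⊆ A) : steinerDist G S + 1 ≤ A.ncard := by
  obtain ⟨H, hH, rfl, hcard⟩ :=
    SimpleGraph.exists_connected_subgraph_of_connected_induce A.toFinite hA
  rw [← hcard, Nat.cast_add, Nat.cast_one]
  gcongr
  exact sInf_le ⟨H, hH, hS, rfl⟩

lemma le_steinerDist_add_one {S : Set V} {m : ℕ}
    (h : ∀ A : Set V, S ⊆ A → (G.induce A).Connected → m ≤ A.ncard) :
    (m : ℕ∞) ≤ steinerDist G S + 1 := by
  suffices ((m - 1 : ℕ) : ℕ∞) ≤ steinerDist G S by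
    calc (m : ℕ∞) ≤ ((m - 1 : ℕ) : ℕ∞) + 1 := by norm_cast; omega
      _ ≤ _ := by gcongr
  refine le_sInf ?_
  rintro _ ⟨H, hH, hS, rfl⟩
  have := h _ hS hH.induce_verts
  have := hH.ncard_verts_le
  norm_cast
  omega

/-- Any connected vertex set containing all vertices but two cut vertices is everything. -/
lemma eq_univ_of_connected_induce (hG : G.Connected) {u v : V} (huv : u ≠ v)
    (hu : IsCutVertex G u) (hv : IsCutVertex G v) {A : Set V} (hA : (G.induce A).Connected)
    (hsub : ({u, v} : Set V)ᶜ ⊆ A) : A = Set.univ := by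
  have key : ∀ x y : V, IsCutVertex G x → ({x, y} : Set V)ᶜ ⊆ A → y ∈ A → x ∈ A := by
    intro x y hx hxy hy
    by_contra hxA
    refine hx ?_
    suffices ({x}ᶜ : Set V) = A by rwa [this]
    ext z
    have := @hxy z
    simp only [Set.mem_compl_iff, Set.mem_insert_iff, Set.mem_singleton_iff] at this ⊢
    grind
  by_cases huA : u ∈ A
  · have hvA := key v u hv (by rwa [Set.pair_comm]) huA
    exact Set.eq_univ_of_forall fun z => by
      by_cases hz : z ∈ ({u, v} : Set V)
      · rcases hz with rfl | rfl <;> assumption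
      · exact hsub hz
  · have hvA : v ∉ A := fun h => huA (key u v hu hsub h)
    have hAeq : A = ({u, v} : Set V)ᶜ := by
      refine Set.Subset.antisymm ?_ hsub
      rintro z hz (rfl | rfl) <;> contradiction
    have hins : ∀ a ∈ A, ¬ G.Adj u a ∧ ¬ G.Adj v a := by
      refine fun a ha => ⟨fun h => hv ?_, fun h => hu ?_⟩
      · rw [show ({v}ᶜ : Set V) = insert u A by grind]
        exact SimpleGraph.connected_induce_insert hA ha h
      · rw [show ({u}ᶜ : Set V) = insert v A by grind]
        exact SimpleGraph.connected_induce_insert hA ha h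
    obtain ⟨a, ha⟩ := Set.nonempty_coe_sort.1 hA.nonempty
    obtain ⟨x, hx, y, hy, hxy⟩ := hG.exists_adj_notMem_of_mem ha huA
    have := hins x hx
    rw [hAeq, Set.notMem_compl_iff] at hy
    rcases hy with rfl | rfl
    · exact (this.1 hxy.symm).elim
    · exact (this.2 hxy.symm).elim

end

/-- For a connected graph `G` of order `n ≥ 4`, `sdiam_{n-2}(G) = n - 1`
if and only if `G` contains at least two cut vertices. -/
theorem sdiam_sub_two_eq_iff_two_cut {V : Type*} [Fintype V] (G : SimpleGraph V)
    (hG : G.Connected) (n : ℕ) (hn : Fintype.card V = n) (hn4 : 4 ≤ n) :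
    sdiam G (n - 2) = (↑(n - 1) : ℕ∞) ↔ 2 ≤ {v : V | IsCutVertex G v}.ncard := by
  have hcard : (Set.univ : Set V).ncard = n := by rw [Set.ncard_univ, Nat.card_eq_fintype_card, hn]
  have hcompl : ∀ s : Set V, s.ncard + sᶜ.ncard = n := fun s => by
    rw [Set.ncard_add_ncard_compl, Nat.card_eq_fintype_card, hn]
  constructor
  · intro h
    by_contra! hlt
    have hle : sdiam G (n - 2) ≤ ((n - 2 : ℕ) : ℕ∞) := by
      refine sSup_le ?_
      rintro _ ⟨S, hS, rfl⟩
      have hSc : Sᶜ.ncard = 2 := by have := hcompl S; omega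
      obtain ⟨x, hx, hxc⟩ := Set.exists_mem_notMem_of_ncard_lt_ncard (hlt.trans_eq hSc.symm)
      have hdist := steinerDist_add_one_le (not_not.1 hxc) (S := S)
        (fun z hz hzx => hx (hzx ▸ hz))
      have : ({x}ᶜ : Set V).ncard = n - 2 + 1 := by
        have := hcompl {x}
        rw [Set.ncard_singleton] at this
        omega
      rw [this, Nat.cast_add, Nat.cast_one] at hdist
      exact (ENat.add_le_add_iff_right ENat.one_ne_top).1 hdist
    rw [h] at hle
    norm_cast at hle
    omega
  · intro h
    refine le_antisymm (sSup_le ?_) ?_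
    · rintro _ ⟨S, -, rfl⟩
      have hdist := steinerDist_add_one_le (S := S) (A := Set.univ)
        ((SimpleGraph.induceUnivIso G).connected_iff.2 hG) (Set.subset_univ S)
      rw [hcard, show n = n - 1 + 1 by omega, Nat.cast_add, Nat.cast_one] at hdist
      exact (ENat.add_le_add_iff_right ENat.one_ne_top).1 hdist
    · obtain ⟨u, hu, v, hv, huv⟩ := (Set.one_lt_ncard (Set.toFinite _)).1 h
      have hdist : (n : ℕ∞) ≤ steinerDist G ({u, v}ᶜ : Set V) + 1 :=
        le_steinerDist_add_one fun A hsub hA => by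
          rw [eq_univ_of_connected_induce hG huv hu hv hA hsub, hcard]
      rw [show n = n - 1 + 1 by omega, Nat.cast_add, Nat.cast_one] at hdist
      refine ((ENat.add_le_add_iff_right ENat.one_ne_top).1 hdist).trans (le_sSup ⟨_, ?_, rfl⟩)
      have := hcompl {u, v}
      rw [Set.ncard_pair huv] at this
      omega
end

section
/- Let G be a connected graph of order n ≥ 5. Then sdiam_{n−3}(G) = n − 4 if and only if κ(G) ≥ 4. -/
open SimpleGraph

section Steiner

variable {V : Type*} {G : SimpleGraph V}

lemma ncard_edgeSet_eq_card_coe_edgeSet (H : G.Subgraph) :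
    H.edgeSet.ncard = Nat.card H.coe.edgeSet := by
  rw [← H.image_coe_edgeSet_coe,
    Set.ncard_image_of_injective _ (Sym2.map.injective Subtype.val_injective),
    ← Nat.card_coe_set_eq]

lemma SimpleGraph.Subgraph.Connected.ncard_verts_le_s13 {H : G.Subgraph} (hH : H.Connected) :
    H.verts.ncard ≤ H.edgeSet.ncard + 1 := by
  rw [ncard_edgeSet_eq_card_coe_edgeSet, ← Nat.card_coe_set_eq]
  exact hH.coe.card_vert_le_card_edgeSet_add_one

lemma le_kappa_iff {k : ℕ} :
    k ≤ kappa G ↔ ∀ U : Set V, U.ncard < k → (G.induce Uᶜ).Connected ∧ Uᶜ.ncard ≠ 1 := by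
  constructor
  · intro h U hU
    by_contra hcon
    have : kappa G ≤ U.ncard := Nat.sInf_le ⟨U, Set.subset_univ _, rfl, by
      rw [← Set.compl_eq_univ_sdiff]; tauto⟩
    omega
  · intro h
    refine le_csInf ⟨_, Set.univ, subset_rfl, rfl, Or.inl fun hc ↦ ?_⟩ ?_
    · obtain ⟨x⟩ := hc.nonempty
      exact x.2.2 x.2.1
    · rintro _ ⟨U, -, rfl, hU⟩
      rw [← Set.compl_eq_univ_sdiff] at hU
      by_contra hlt
      have := h U (by omega)
      tauto

variable [Finite V]

/-- A connected induced subgraph has a spanning tree. -/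
lemma exists_connected_subgraph_ncard_edgeSet {S : Set V} (hS : (G.induce S).Connected) :
    ∃ H : G.Subgraph, H.Connected ∧ H.verts = S ∧ H.edgeSet.ncard + 1 = S.ncard := by
  obtain ⟨T, hT, hTree⟩ := hS.exists_isTree_le
  let H : G.Subgraph :=
    { verts := S
      Adj := fun a b ↦ ∃ (ha : a ∈ S) (hb : b ∈ S), T.Adj ⟨a, ha⟩ ⟨b, hb⟩
      adj_sub := fun ⟨_, _, h⟩ ↦ hT h
      edge_vert := fun ⟨ha, _, _⟩ ↦ ha
      symm := ⟨fun _ _ ⟨ha, hb, h⟩ ↦ ⟨hb, ha, h.symm⟩⟩ }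
  have hH : H.coe = T := by
    ext a b
    exact ⟨fun ⟨_, _, h⟩ ↦ h, fun h ↦ ⟨a.2, b.2, h⟩⟩
  refine ⟨H, ⟨hH ▸ hTree.connected⟩, rfl, ?_⟩
  rw [ncard_edgeSet_eq_card_coe_edgeSet, hH, ← Nat.card_coe_set_eq]
  exact (isTree_iff_connected_and_card.mp hTree).2

lemma ncard_le_steinerDist_add_one (G : SimpleGraph V) (S : Set V) :
    (S.ncard : ℕ∞) ≤ steinerDist G S + 1 := by
  rw [← tsub_le_iff_right]
  refine le_sInf ?_
  rintro _ ⟨H, hH, hS, rfl⟩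
  rw [tsub_le_iff_right]
  exact_mod_cast (Set.ncard_le_ncard hS).trans hH.ncard_verts_le_s13

lemma steinerDist_add_one_le_ncard_iff {S : Set V} :
    steinerDist G S + 1 ≤ S.ncard ↔ (G.induce S).Connected := by
  constructor
  · intro h
    have hne : {m : ℕ∞ | ∃ H : G.Subgraph, H.Connected ∧ S ⊆ H.verts ∧
        m = H.edgeSet.ncard}.Nonempty := by
      by_contra hne
      rw [Set.not_nonempty_iff_eq_empty] at hne
      rw [steinerDist, hne, sInf_empty, top_add] at h
      exact ENat.natCast_ne_top _ (top_le_iff.mp h)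
    obtain ⟨H, hH, hS, hm⟩ := csInf_mem hne
    change steinerDist G S = _ at hm
    rw [hm] at h
    have hcard : H.edgeSet.ncard + 1 ≤ S.ncard := by exact_mod_cast h
    rw [Set.eq_of_subset_of_ncard_le hS (hH.ncard_verts_le_s13.trans hcard)]
    exact hH.induce_verts
  · intro h
    obtain ⟨H, hH, hS, hcard⟩ := exists_connected_subgraph_ncard_edgeSet h
    rw [← hcard, Nat.cast_add, Nat.cast_one]
    gcongr
    exact sInf_le ⟨H, hH, hS.ge, rfl⟩

lemma sdiam_eq_iff_forall_connected {k : ℕ} (hk : k + 1 ≤ Nat.card V) :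
    sdiam G (k + 1) = k ↔ ∀ S : Set V, S.ncard = k + 1 → (G.induce S).Connected := by
  constructor
  · intro h S hS
    rw [← steinerDist_add_one_le_ncard_iff, hS, Nat.cast_add, Nat.cast_one, ← h]
    gcongr
    exact le_sSup ⟨S, hS, rfl⟩
  · intro h
    apply le_antisymm
    · refine sSup_le ?_
      rintro _ ⟨S, hS, rfl⟩
      have := steinerDist_add_one_le_ncard_iff.mpr (h S hS)
      rw [hS, Nat.cast_add, Nat.cast_one] at this
      exact (WithTop.add_le_add_iff_right ENat.one_ne_top).mp this
    · obtain ⟨S, -, hS⟩ := Set.exists_subset_card_eq (s := (Set.univ : Set V))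
        (n := k + 1) (by rwa [Set.ncard_univ])
      have := ncard_le_steinerDist_add_one G S
      rw [hS, Nat.cast_add, Nat.cast_one] at this
      exact ((WithTop.add_le_add_iff_right ENat.one_ne_top).mp this).trans (le_sSup ⟨S, hS, rfl⟩)

/-- If all `k`-subsets induce connected subgraphs, `2 ≤ k`, then so do all larger subsets. -/
lemma connected_induce_of_forall_ncard_eq {k : ℕ} (hk : 2 ≤ k)
    (h : ∀ S : Set V, S.ncard = k → (G.induce S).Connected) {A : Set V} (hA : k ≤ A.ncard) :
    (G.induce A).Connected := by
  have hne : A.Nonempty := (Set.ncard_pos).mp (by omega)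
  refine (connected_iff _).mpr ⟨fun x y ↦ ?_, hne.to_subtype⟩
  obtain ⟨S, hxy, hSA, hS⟩ := Set.exists_subsuperset_card_eq
    (Set.pair_subset x.2 y.2) ((Set.ncard_insert_le _ _).trans (by simpa using hk)) hA
  exact ((h S hS).preconnected ⟨x, hxy (by simp)⟩ ⟨y, hxy (by simp)⟩).map
    (induceHomOfLE G hSA).toHom

end Steiner

/-- For a connected graph `G` of order `n ≥ 5`, `sdiam_{n-3}(G) = n - 4`
if and only if `κ(G) ≥ 4`. -/
theorem sdiam_sub_three_eq_iff_kappa {V : Type*} [Fintype V] (G : SimpleGraph V)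
    (hG : G.Connected) (n : ℕ) (hn : Fintype.card V = n) (hn5 : 5 ≤ n) :
    sdiam G (n - 3) = (↑(n - 4) : ℕ∞) ↔ 4 ≤ kappa G := by
  have hcard : Nat.card V = n := by rw [Nat.card_eq_fintype_card, hn]
  have hcompl (U : Set V) : U.ncard + Uᶜ.ncard = n := hcard ▸ Set.ncard_add_ncard_compl U
  rw [show n - 3 = n - 4 + 1 by omega, sdiam_eq_iff_forall_connected (by omega), le_kappa_iff]
  constructor
  · intro h U hU
    have := hcompl U
    exact ⟨connected_induce_of_forall_ncard_eq (by omega) h (by omega), by omega⟩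
  · intro h S hS
    have := hcompl S
    exact compl_compl S ▸ (h Sᶜ (by omega)).1
end
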